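/- arXiv:1812.10125 — 2 statements merged into one kernel-verified Lean document; each statement's English description precedes it below -/
import Mathlib

section
/- Let X be a compact metric space, E ⊂ X a finite nonempty proper subset, and W : X∖E → [1,∞) a continuous function. Let 𝒞⋆ be the set of continuous functions f : X∖E → ℝ with sup_{x∈X∖E} |f(x)|/W(x) < ∞, and define ‖f‖_⋆ := sup_{x∈X∖E} |f(x)|/(log⋆(dist(x,E))·W(x)), where log⋆(t) = 1 + |log t|. Then the continuous functions with compact support contained in X∖E are dense in (𝒞⋆, ‖·‖_⋆): for every f ∈ 𝒞⋆ and every δ > 0 there exists a continuous g : X∖E → ℝ whose support is a compact subset of X∖E such that ‖f − g‖_⋆ ≤ δ. -/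
/-- The log-type function `log⋆(t) = 1 + |log t|`. -/
noncomputable def logStar (t : ℝ) : ℝ := 1 + |Real.log t|

/-- Let `X` be a compact metric space, `E ⊂ X` a finite nonempty
proper subset, and `W : X∖E → [1,∞)` continuous.  For `f` continuous on `X∖E` with
`sup |f|/W < ∞` and any `δ > 0`, there is a continuous function `g` on `X∖E` whose
support is a compact subset of `X∖E` with
`|f(x) − g(x)| ≤ δ·(log⋆ dist(x,E))·W(x)` for all `x ∉ E`; i.e. compactly supported
continuous functions are dense in the weighted space `(𝒞⋆, ‖·‖_⋆)`. -/
theorem stmt18 {X : Type*} [MetricSpace X] [CompactSpace X]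
    (E : Set X) (hEfin : E.Finite) (hEne : E.Nonempty) (hEproper : E ≠ Set.univ)
    (W : X → ℝ) (hWc : ContinuousOn W Eᶜ) (hW1 : ∀ x ∉ E, 1 ≤ W x)
    (f : X → ℝ) (hfc : ContinuousOn f Eᶜ)
    (hfb : ∃ M : ℝ, ∀ x ∉ E, |f x| ≤ M * W x)
    (δ : ℝ) (hδ : 0 < δ) :
    ∃ g : X → ℝ, ContinuousOn g Eᶜ ∧
      (∃ K : Set X, IsCompact K ∧ K ⊆ Eᶜ ∧ ∀ x ∉ K, g x = 0) ∧
      ∀ x ∉ E, |f x - g x| ≤ δ * (logStar (Metric.infDist x E) * W x) := by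
  obtain ⟨M, hM⟩ := hfb
  set r : ℝ := Real.exp (-(|M| / δ)) with hr
  have hr0 : 0 < r := Real.exp_pos _
  set χ : X → ℝ := fun x => min 1 (max 0 (2 * Metric.infDist x E / r - 1)) with hχ
  have hχc : Continuous χ := by
    have := Metric.continuous_infDist_pt E
    fun_prop
  have hχ0 : ∀ x, 0 ≤ χ x := fun x => le_min zero_le_one (le_max_left _ _)
  have hχ1 : ∀ x, χ x ≤ 1 := fun x => min_le_left _ _
  refine ⟨fun x => χ x * f x, hχc.continuousOn.mul hfc,
    ⟨{x | r / 2 ≤ Metric.infDist x E}, ?_, ?_, ?_⟩, ?_⟩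
  · exact (isClosed_le continuous_const (Metric.continuous_infDist_pt E)).isCompact
  · intro x hx hxE
    have hx' : r / 2 ≤ Metric.infDist x E := hx
    rw [Metric.infDist_zero_of_mem hxE] at hx'
    linarith
  · intro x hx
    have hx' : Metric.infDist x E < r / 2 := not_le.mp hx
    have h : 2 * Metric.infDist x E / r - 1 ≤ 0 := by
      rw [sub_nonpos, div_le_one hr0]
      linarith
    have hz : χ x = 0 := by simp [hχ, max_eq_left h]
    simp [hz]
  · intro x hx
    have hd : 0 < Metric.infDist x E :=
      (hEfin.isClosed.notMem_iff_infDist_pos hEne).mp hx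
    have hW : 0 ≤ W x := zero_le_one.trans (hW1 x hx)
    rcases le_or_gt r (Metric.infDist x E) with h | h
    · have h1 : 1 ≤ 2 * Metric.infDist x E / r - 1 := by
        rw [le_sub_iff_add_le, le_div_iff₀ hr0]
        linarith
      have hone : χ x = 1 := min_eq_left (h1.trans (le_max_right _ _))
      have hlog : 0 ≤ logStar (Metric.infDist x E) := by
        unfold logStar
        positivity
      simp only [hone, one_mul, sub_self, abs_zero]
      positivity
    · have hlog : Real.log (Metric.infDist x E) < -(|M| / δ) :=
        (Real.log_lt_iff_lt_exp hd).mpr h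
      have hstar : |M| / δ ≤ logStar (Metric.infDist x E) := by
        unfold logStar
        linarith [neg_le_abs (Real.log (Metric.infDist x E))]
      calc |f x - χ x * f x| = (1 - χ x) * |f x| := by
            rw [← one_sub_mul, abs_mul, abs_of_nonneg (sub_nonneg.mpr (hχ1 x))]
        _ ≤ |f x| := mul_le_of_le_one_left (abs_nonneg _) (by linarith [hχ0 x])
        _ ≤ M * W x := hM x hx
        _ ≤ |M| * W x := by gcongr; exact le_abs_self M
        _ ≤ (δ * logStar (Metric.infDist x E)) * W x := by
            gcongr
            exact (div_le_iff₀' hδ).mp hstar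
        _ = δ * (logStar (Metric.infDist x E) * W x) := mul_assoc _ _ _
end

section
/- There exists a constant c > 0 with the following property: for every twice continuously differentiable function χ : ℝ² → ℝ, ∫_{B(0,1)} ‖∇χ(x)‖²·e^{−2χ(x)} dx ≤ c·∫_{B(0,2)} e^{−2χ(x)} dx + c·∫_{B(0,2)} |Δχ(x)|·e^{−2χ(x)} dx, where B(0,r) denotes the open Euclidean ball of radius r centered at 0, ∇χ the gradient, and Δχ = ∂²χ/∂u² + ∂²χ/∂v² the Laplacian. -/
open MeasureTheory

/-- The Euclidean Laplacian `Δχ = ∂²χ/∂u² + ∂²χ/∂v²` of a function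
`χ : ℝ² → ℝ` on the Euclidean plane. -/
noncomputable def laplacianR2 (f : EuclideanSpace ℝ (Fin 2) → ℝ)
    (x : EuclideanSpace ℝ (Fin 2)) : ℝ :=
  ∑ i : Fin 2,
    fderiv ℝ (fun y => fderiv ℝ f y (EuclideanSpace.single i 1)) x (EuclideanSpace.single i 1)

/-- The squared operator norm of a functional on Euclidean space is the sum of the squares of its
values on the standard basis. -/
lemma norm_sq_eq_sum_apply_single {n : ℕ} (L : EuclideanSpace ℝ (Fin n) →L[ℝ] ℝ) :
    ‖L‖ ^ 2 = ∑ i, L (EuclideanSpace.single i 1) ^ 2 := by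
  rw [← (InnerProductSpace.toDual ℝ (EuclideanSpace ℝ (Fin n))).symm.norm_map L,
    EuclideanSpace.norm_sq_eq]
  refine Finset.sum_congr rfl fun i _ => ?_
  rw [← InnerProductSpace.toDual_symm_apply (x := EuclideanSpace.single i 1) (y := L),
    EuclideanSpace.inner_single_right]
  simp

/-- The integral of a directional derivative of a compactly supported `C¹` function vanishes. -/
lemma integral_fderiv_apply_eq_zero {n : ℕ} {f : EuclideanSpace ℝ (Fin n) → ℝ}
    (hf : ContDiff ℝ 1 f) (hs : HasCompactSupport f) (v : EuclideanSpace ℝ (Fin n)) :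
    ∫ x, fderiv ℝ f x v = 0 := by
  have h := integral_mul_fderiv_eq_neg_fderiv_mul_of_integrable (μ := volume) (f := f)
    (g := fun _ : EuclideanSpace ℝ (Fin n) => (1 : ℝ)) (v := v)
    (by simpa using ((hf.continuous_fderiv one_ne_zero).clm_apply
      continuous_const).integrable_of_hasCompactSupport (hs.fderiv_apply (𝕜 := ℝ) v))
    (by simp) (by simpa using hf.continuous.integrable_of_hasCompactSupport hs)
    (fun x _ => hf.differentiable one_ne_zero x) (fun x _ => differentiableAt_const _)
  simpa using h.symm

lemma ContDiff.fderiv_apply_const {n : ℕ} {m k : WithTop ℕ∞} {f : EuclideanSpace ℝ (Fin n) → ℝ}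
    (hf : ContDiff ℝ k f) (hmk : m + 1 ≤ k) (v : EuclideanSpace ℝ (Fin n)) :
    ContDiff ℝ m fun y => fderiv ℝ f y v :=
  (hf.fderiv_right hmk).clm_apply contDiff_const

lemma continuous_laplacianR2 {f : EuclideanSpace ℝ (Fin 2) → ℝ} (hf : ContDiff ℝ 2 f) :
    Continuous (laplacianR2 f) :=
  continuous_finsetSum _ fun i _ =>
    ((hf.fderiv_apply_const (m := 1) (by norm_num) (EuclideanSpace.single i 1)).fderiv_apply_const
      (m := 0) (by norm_num) (EuclideanSpace.single i 1)).continuous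

lemma support_laplacianR2_subset (f : EuclideanSpace ℝ (Fin 2) → ℝ) :
    Function.support (laplacianR2 f) ⊆ tsupport f := by
  intro x hx
  by_contra h
  refine Function.mem_support.mp hx (Finset.sum_eq_zero fun i _ => ?_)
  let v : EuclideanSpace ℝ (Fin 2) := EuclideanSpace.single i 1
  exact image_eq_zero_of_notMem_tsupport (f := fun z => fderiv ℝ (fun y => fderiv ℝ f y v) z v)
    fun h' => h (tsupport_fderiv_apply_subset ℝ v (tsupport_fderiv_apply_subset ℝ v h'))

/-- Weighted Bochner-type identity obtained by integrating the divergence of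
`(θ ∇χ + ½ ∇θ) e^{-2χ}`. -/
lemma integral_norm_fderiv_sq_mul_exp_eq {θ χ : EuclideanSpace ℝ (Fin 2) → ℝ}
    (hθ : ContDiff ℝ 2 θ) (hs : HasCompactSupport θ) (hχ : ContDiff ℝ 2 χ) :
    ∫ x, θ x * (‖fderiv ℝ χ x‖ ^ 2 * Real.exp (-2 * χ x)) =
      ∫ x, (θ x * laplacianR2 χ x / 2 + laplacianR2 θ x / 4) * Real.exp (-2 * χ x) := by
  let e : Fin 2 → EuclideanSpace ℝ (Fin 2) := fun i => EuclideanSpace.single i 1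
  let V : Fin 2 → EuclideanSpace ℝ (Fin 2) → ℝ := fun i y =>
    (θ y * fderiv ℝ χ y (e i) + fderiv ℝ θ y (e i) / 2) * Real.exp (-2 * χ y)
  have hχ' (i : Fin 2) : ContDiff ℝ 1 fun y => fderiv ℝ χ y (e i) :=
    hχ.fderiv_apply_const (by norm_num) _
  have hθ' (i : Fin 2) : ContDiff ℝ 1 fun y => fderiv ℝ θ y (e i) :=
    hθ.fderiv_apply_const (by norm_num) _
  have hχ1 : ContDiff ℝ 1 χ := hχ.of_le (by norm_num)
  have hθ1 : ContDiff ℝ 1 θ := hθ.of_le (by norm_num)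
  have hV (i : Fin 2) : ContDiff ℝ 1 (V i) :=
    ((hθ1.mul (hχ' i)).add ((hθ' i).div_const 2)).mul (contDiff_const.mul hχ1).exp
  have hVs (i : Fin 2) : HasCompactSupport (V i) :=
    (hs.mul_right.add ((hs.fderiv_apply (𝕜 := ℝ) (e i)).comp_left
      (g := fun t : ℝ => t / 2) (zero_div 2))).mul_right
  have hderiv (i : Fin 2) (x : EuclideanSpace ℝ (Fin 2)) : fderiv ℝ (V i) x (e i) =
      (θ x * fderiv ℝ (fun y => fderiv ℝ χ y (e i)) x (e i)
        + fderiv ℝ (fun y => fderiv ℝ θ y (e i)) x (e i) / 2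
        - 2 * θ x * fderiv ℝ χ x (e i) ^ 2) * Real.exp (-2 * χ x) := by
    have h1 := ((hχ' i).differentiable one_ne_zero x).hasFDerivAt
    have h2 := ((hθ' i).differentiable one_ne_zero x).hasFDerivAt
    have h3 := (hχ1.differentiable one_ne_zero x).hasFDerivAt
    have h4 := (hθ1.differentiable one_ne_zero x).hasFDerivAt
    have h := ((h4.mul h1).add (h2.mul_const (2⁻¹ : ℝ))).mul (h3.const_mul (-2)).exp
    have hV' : V i = ((θ * fun y => fderiv ℝ χ y (e i)) + fun y => fderiv ℝ θ y (e i) * 2⁻¹) *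
        fun y => Real.exp (-2 * χ y) := by
      ext y; simp [V, div_eq_mul_inv]
    rw [hV', h.fderiv]
    simp
    ring
  have hVint (i : Fin 2) : Integrable fun x => fderiv ℝ (V i) x (e i) :=
    (((hV i).continuous_fderiv one_ne_zero).clm_apply
      continuous_const).integrable_of_hasCompactSupport ((hVs i).fderiv_apply (𝕜 := ℝ) (e i))
  have hzero : ∫ x, ∑ i, fderiv ℝ (V i) x (e i) = 0 := by
    rw [integral_finsetSum _ fun i _ => hVint i]
    exact Finset.sum_eq_zero fun i _ => integral_fderiv_apply_eq_zero (hV i) (hVs i) (e i)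
  have hL : Integrable fun x => θ x * (‖fderiv ℝ χ x‖ ^ 2 * Real.exp (-2 * χ x)) :=
    (hθ.continuous.mul (((hχ.continuous_fderiv two_ne_zero).norm.pow 2).mul
      (continuous_const.mul hχ.continuous).rexp)).integrable_of_hasCompactSupport hs.mul_right
  have hsum := integral_add ((integrable_finsetSum Finset.univ fun i _ => hVint i).div_const 2) hL
  rw [integral_div, hzero, zero_div, zero_add] at hsum
  rw [← hsum]
  refine integral_congr_ae (.of_forall fun x => ?_)
  simp only [hderiv, norm_sq_eq_sum_apply_single, laplacianR2, Fin.sum_univ_two, e]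
  ring

/-- There is a constant `c > 0` such that for every `C²` function
`χ : ℝ² → ℝ`,
`∫_{B(0,1)} ‖∇χ‖²·e^{−2χ} ≤ c·∫_{B(0,2)} e^{−2χ} + c·∫_{B(0,2)} |Δχ|·e^{−2χ}`
(a Caccioppoli-type inequality). -/
theorem stmt19 :
    ∃ c : ℝ, 0 < c ∧
      ∀ χ : EuclideanSpace ℝ (Fin 2) → ℝ, ContDiff ℝ 2 χ →
        (∫ x in Metric.ball (0 : EuclideanSpace ℝ (Fin 2)) 1,
            ‖fderiv ℝ χ x‖ ^ 2 * Real.exp (-2 * χ x)) ≤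
          c * (∫ x in Metric.ball (0 : EuclideanSpace ℝ (Fin 2)) 2, Real.exp (-2 * χ x)) +
            c * (∫ x in Metric.ball (0 : EuclideanSpace ℝ (Fin 2)) 2,
              |laplacianR2 χ x| * Real.exp (-2 * χ x)) := by
  let θ : ContDiffBump (0 : EuclideanSpace ℝ (Fin 2)) := ⟨1, 3 / 2, one_pos, by norm_num⟩
  have hθ : ContDiff ℝ 2 θ := θ.contDiff
  have hθB : tsupport θ ⊆ Metric.ball 0 2 := by
    rw [θ.tsupport_eq]
    exact Metric.closedBall_subset_ball (by norm_num [θ])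
  have hlapθ := continuous_laplacianR2 hθ
  obtain ⟨C, hC⟩ := hlapθ.bounded_above_of_compact_support
    (θ.hasCompactSupport.mono' (support_laplacianR2_subset θ))
  have hC0 : 0 ≤ C := (norm_nonneg _).trans (hC 0)
  refine ⟨C + 1, by positivity, fun χ hχ => ?_⟩
  have hexp : Continuous fun x => Real.exp (-2 * χ x) :=
    (continuous_const.mul hχ.continuous).rexp
  have hlap := continuous_laplacianR2 hχ
  have hgrad : Continuous fun x => ‖fderiv ℝ χ x‖ ^ 2 * Real.exp (-2 * χ x) :=
    ((hχ.continuous_fderiv two_ne_zero).norm.pow 2).mul hexp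
  have hball {f : EuclideanSpace ℝ (Fin 2) → ℝ} (hf : Continuous f) :
      IntegrableOn f (Metric.ball 0 2) :=
    (hf.continuousOn.integrableOn_compact (isCompact_closedBall 0 2)).mono_set
      Metric.ball_subset_closedBall
  calc ∫ x in Metric.ball 0 1, ‖fderiv ℝ χ x‖ ^ 2 * Real.exp (-2 * χ x)
      = ∫ x in Metric.ball 0 1, θ x * (‖fderiv ℝ χ x‖ ^ 2 * Real.exp (-2 * χ x)) := by
        refine setIntegral_congr_fun measurableSet_ball fun x hx => ?_
        simp [θ.one_of_mem_closedBall (Metric.ball_subset_closedBall hx)]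
    _ ≤ ∫ x, θ x * (‖fderiv ℝ χ x‖ ^ 2 * Real.exp (-2 * χ x)) := by
        refine setIntegral_le_integral ((hθ.continuous.mul hgrad).integrable_of_hasCompactSupport
          θ.hasCompactSupport.mul_right) (.of_forall fun x => ?_)
        have := θ.nonneg' x
        simp only [Pi.zero_apply]
        positivity
    _ = ∫ x, (θ x * laplacianR2 χ x / 2 + laplacianR2 θ x / 4) * Real.exp (-2 * χ x) :=
        integral_norm_fderiv_sq_mul_exp_eq hθ θ.hasCompactSupport hχ
    _ = ∫ x in Metric.ball 0 2,
          (θ x * laplacianR2 χ x / 2 + laplacianR2 θ x / 4) * Real.exp (-2 * χ x) := by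
        refine (setIntegral_eq_integral_of_forall_compl_eq_zero fun x hx => ?_).symm
        have h1 : θ x = 0 := image_eq_zero_of_notMem_tsupport fun h => hx (hθB h)
        have h2 : laplacianR2 θ x = 0 :=
          Function.notMem_support.mp fun h => hx (hθB (support_laplacianR2_subset θ h))
        simp [h1, h2]
    _ ≤ ∫ x in Metric.ball 0 2, ((C + 1) * Real.exp (-2 * χ x) +
          (C + 1) * (|laplacianR2 χ x| * Real.exp (-2 * χ x))) := by
        refine integral_mono (hball ((((hθ.continuous.mul hlap).div_const 2).add
          (hlapθ.div_const 4)).mul hexp)) (hball (by fun_prop)) fun x => ?_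
        have h1 : laplacianR2 θ x ≤ C := (le_abs_self _).trans (hC x)
        have h2 : θ x * laplacianR2 χ x ≤ |laplacianR2 χ x| :=
          (mul_le_mul_of_nonneg_left (le_abs_self _) θ.nonneg).trans
            (mul_le_of_le_one_left (abs_nonneg _) θ.le_one)
        have h3 := mul_nonneg hC0 (abs_nonneg (laplacianR2 χ x))
        have h4 := abs_nonneg (laplacianR2 χ x)
        calc _ ≤ ((C + 1) + (C + 1) * |laplacianR2 χ x|) * Real.exp (-2 * χ x) := by
              refine mul_le_mul_of_nonneg_right ?_ (Real.exp_pos _).le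
              linarith
          _ = _ := by ring
    _ = _ := by
        rw [integral_add (hball (by fun_prop)) (hball (by fun_prop)), integral_const_mul,
          integral_const_mul]
end
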